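/- arXiv:2502.09521 — 3 statements merged into one kernel-verified Lean document; each statement's English description precedes it below -/
import Mathlib

section
/- Let ρ > 0. For every z ∈ [ρ/2, ρ], φ_ρ(z) + ∫₀^z φ_ρ(τ) dτ = 1; that is, the integral feasibility constraint holds with equality on the second half of the interval. -/
/-- The function `φ_ρ` from the paper, defined piecewise on `[0, ρ]`. -/
noncomputable def phi (ρ : ℝ) (z : ℝ) : ℝ :=
  if z ≤ ρ / 2 then (2 * Real.exp (ρ / 2) - Real.exp z) / (1 + Real.exp (ρ / 2) * ρ)
  else Real.exp (ρ - z) / (1 + Real.exp (ρ / 2) * ρ)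

theorem phi_of_le {ρ z : ℝ} (hz : z ≤ ρ / 2) :
    phi ρ z = (2 * Real.exp (ρ / 2) - Real.exp z) / (1 + Real.exp (ρ / 2) * ρ) :=
  if_pos hz

theorem phi_of_ge {ρ z : ℝ} (hz : ρ / 2 ≤ z) :
    phi ρ z = Real.exp (ρ - z) / (1 + Real.exp (ρ / 2) * ρ) := by
  rcases hz.eq_or_lt with rfl | h
  · rw [phi_of_le le_rfl, sub_half]
    ring
  · exact if_neg h.not_ge

theorem continuous_phi (ρ : ℝ) : Continuous (phi ρ) := by
  unfold phi
  refine Continuous.if_le (by fun_prop) (by fun_prop) continuous_id continuous_const ?_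
  rintro z rfl
  rw [← phi_of_ge le_rfl, phi_of_le le_rfl]

theorem integral_phi_left {ρ : ℝ} (hρ : 0 ≤ ρ) :
    ∫ τ in (0:ℝ)..(ρ / 2), phi ρ τ =
      (ρ * Real.exp (ρ / 2) - Real.exp (ρ / 2) + 1) / (1 + Real.exp (ρ / 2) * ρ) := by
  have h : Set.EqOn (phi ρ)
      (fun τ => (2 * Real.exp (ρ / 2) - Real.exp τ) / (1 + Real.exp (ρ / 2) * ρ))
      (Set.uIcc 0 (ρ / 2)) := by
    intro τ hτ
    rw [Set.uIcc_of_le (by linarith)] at hτ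
    exact phi_of_le hτ.2
  rw [intervalIntegral.integral_congr h, intervalIntegral.integral_div,
    intervalIntegral.integral_sub (by simp) (Real.continuous_exp.intervalIntegrable _ _),
    intervalIntegral.integral_const, integral_exp, Real.exp_zero, smul_eq_mul]
  ring

theorem integral_phi_right {ρ z : ℝ} (hz : ρ / 2 ≤ z) :
    ∫ τ in (ρ / 2)..z, phi ρ τ =
      (Real.exp (ρ / 2) - Real.exp (ρ - z)) / (1 + Real.exp (ρ / 2) * ρ) := by
  have h : Set.EqOn (phi ρ) (fun τ => Real.exp (ρ - τ) / (1 + Real.exp (ρ / 2) * ρ))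
      (Set.uIcc (ρ / 2) z) := by
    intro τ hτ
    rw [Set.uIcc_of_le hz] at hτ
    exact phi_of_ge hτ.1
  rw [intervalIntegral.integral_congr h, intervalIntegral.integral_div,
    intervalIntegral.integral_comp_sub_left Real.exp, integral_exp, sub_half]

theorem stmt3 (ρ : ℝ) (hρ : 0 < ρ) :
    ∀ z ∈ Set.Icc (ρ / 2) ρ, phi ρ z + (∫ τ in (0:ℝ)..z, phi ρ τ) = 1 := by
  intro z hz
  have hD : 1 + Real.exp (ρ / 2) * ρ ≠ 0 := by positivity
  rw [← intervalIntegral.integral_add_adjacent_intervals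
      ((continuous_phi ρ).intervalIntegrable 0 (ρ / 2))
      ((continuous_phi ρ).intervalIntegrable (ρ / 2) z),
    integral_phi_left hρ.le, integral_phi_right hz.1, phi_of_ge hz.1]
  field_simp
  ring
end

section
/- Fix ρ > 0, n ∈ ℕ, and x = (x_1,…,x_n) with 0 < x_i ≤ 1 for all i and Σ_{i=1}^n x_i = ρ. Define x_f(i) := Σ_{j<i} x_j and x_b(i) := Σ_{j>i} x_j, and set c_f(i) := (1/x_i)·∫_{x_f(i)}^{x_f(i)+x_i} φ_ρ(τ) dτ and c_b(i) := (1/x_i)·∫_{x_b(i)}^{x_b(i)+x_i} φ_ρ(τ) dτ. Then (c_f, c_b) is LP-feasible for (n,x), and moreover (c_f(i) + c_b(i))/2 = α₀(ρ) for every i ∈ {1,…,n}; in particular min_{1≤i≤n} (c_f(i)+c_b(i))/2 = α₀(ρ). -/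
/-- The constant `α₀(ρ) = exp(ρ/2)/(1 + exp(ρ/2)·ρ)`. -/
noncomputable def alpha0 (ρ : ℝ) : ℝ := Real.exp (ρ / 2) / (1 + Real.exp (ρ / 2) * ρ)

/-- A pair of nonnegative vectors `(cf, cb)` (indexed `0, …, n-1`) is LP-feasible for `(n, x)`
if `cf i + ∑_{j < i} x j · cf j ≤ 1` and `cb i + ∑_{j > i} x j · cb j ≤ 1` for all `i < n`. -/
def LPFeasible (n : ℕ) (x cf cb : ℕ → ℝ) : Prop :=
  (∀ i < n, 0 ≤ cf i) ∧ (∀ i < n, 0 ≤ cb i) ∧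
  (∀ i < n, cf i + ∑ j ∈ Finset.range i, x j * cf j ≤ 1) ∧
  (∀ i < n, cb i + ∑ j ∈ Finset.Ico (i + 1) n, x j * cb j ≤ 1)

theorem phi_denom_pos {ρ : ℝ} (hρ : 0 < ρ) : 0 < 1 + Real.exp (ρ / 2) * ρ := by positivity

theorem exp_sub_half (ρ : ℝ) : Real.exp (ρ - ρ / 2) = Real.exp (ρ / 2) := by
  congr 1; ring

theorem phi_intervalIntegrable (ρ a b : ℝ) :
    IntervalIntegrable (phi ρ) MeasureTheory.volume a b :=
  (continuous_phi ρ).intervalIntegrable a b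

theorem phi_nonneg {ρ : ℝ} (hρ : 0 < ρ) (z : ℝ) : 0 ≤ phi ρ z := by
  have hD := phi_denom_pos hρ
  unfold phi
  split_ifs with h
  · have h1 := Real.exp_le_exp.2 h
    have h2 := Real.exp_pos (ρ / 2)
    exact div_nonneg (by linarith) hD.le
  · positivity

theorem antitone_phi {ρ : ℝ} (hρ : 0 < ρ) : Antitone (phi ρ) := by
  intro a b hab
  have hD := phi_denom_pos hρ
  unfold phi
  split_ifs with hb ha ha
  · have := Real.exp_le_exp.2 hab
    gcongr
  · linarith
  · have h1 := Real.exp_le_exp.2 ha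
    have h2 : Real.exp (ρ - b) ≤ Real.exp (ρ / 2) := Real.exp_le_exp.2 (by linarith)
    gcongr
    linarith
  · gcongr

theorem phi_add_phi_reflect (ρ z : ℝ) : phi ρ z + phi ρ (ρ - z) = 2 * alpha0 ρ := by
  unfold phi alpha0
  split_ifs with h1 h2 h2
  · obtain rfl : z = ρ / 2 := by linarith
    rw [exp_sub_half]
    ring
  · rw [sub_sub_cancel]
    ring
  · ring
  · linarith

theorem integral_phi_of_le_half {ρ a : ℝ} (ha0 : 0 ≤ a) (ha : a ≤ ρ / 2) :
    ∫ τ in (0 : ℝ)..a, phi ρ τ =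
      (2 * Real.exp (ρ / 2) * a - Real.exp a + 1) / (1 + Real.exp (ρ / 2) * ρ) := by
  have h : ∫ τ in (0 : ℝ)..a, phi ρ τ = ∫ τ in (0 : ℝ)..a,
      (2 * Real.exp (ρ / 2) - Real.exp τ) / (1 + Real.exp (ρ / 2) * ρ) := by
    refine intervalIntegral.integral_congr fun τ hτ => ?_
    rw [Set.uIcc_of_le ha0] at hτ
    exact if_pos (hτ.2.trans ha)
  rw [h, intervalIntegral.integral_div, intervalIntegral.integral_sub
    (by simp) (Real.continuous_exp.intervalIntegrable _ _), integral_exp]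
  simp
  ring

theorem integral_phi_of_half_le {ρ a : ℝ} (ha : ρ / 2 ≤ a) :
    ∫ τ in (ρ / 2)..a, phi ρ τ =
      (Real.exp (ρ / 2) - Real.exp (ρ - a)) / (1 + Real.exp (ρ / 2) * ρ) := by
  have h : ∫ τ in (ρ / 2)..a, phi ρ τ = ∫ τ in (ρ / 2)..a,
      Real.exp (ρ - τ) / (1 + Real.exp (ρ / 2) * ρ) := by
    refine intervalIntegral.integral_congr fun τ hτ => ?_
    rw [Set.uIcc_of_le ha] at hτ
    rcases hτ.1.eq_or_lt with rfl | hlt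
    · simp only [phi, le_refl, if_true, exp_sub_half]
      ring
    · exact if_neg hlt.not_ge
  rw [h, intervalIntegral.integral_div,
    intervalIntegral.integral_comp_sub_left (fun τ => Real.exp τ), integral_exp, exp_sub_half]

theorem phi_add_integral_le_one {ρ a : ℝ} (hρ : 0 < ρ) (ha0 : 0 ≤ a) :
    phi ρ a + ∫ τ in (0 : ℝ)..a, phi ρ τ ≤ 1 := by
  have hD := phi_denom_pos hρ
  rcases le_or_gt a (ρ / 2) with h | h
  · rw [integral_phi_of_le_half ha0 h, phi, if_pos h, ← add_div, div_le_one hD]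
    have h1 := Real.add_one_le_exp (a - ρ / 2)
    have h2 : Real.exp a = Real.exp (ρ / 2) * Real.exp (a - ρ / 2) := by
      rw [← Real.exp_add]
      congr 1; ring
    have h3 := mul_le_mul_of_nonneg_left h1 (Real.exp_pos (ρ / 2)).le
    rw [← h2] at h3
    linarith
  · rw [← intervalIntegral.integral_add_adjacent_intervals (phi_intervalIntegrable ρ 0 (ρ / 2))
      (phi_intervalIntegrable ρ (ρ / 2) a), integral_phi_of_le_half (by positivity) le_rfl,
      integral_phi_of_half_le h.le, phi, if_neg h.not_ge, ← add_div, ← add_div, div_le_one hD]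
    linarith

theorem average_phi_add_integral_le_one {ρ a t : ℝ} (hρ : 0 < ρ) (ha0 : 0 ≤ a) (ht : 0 < t) :
    (1 / t) * (∫ τ in a..(a + t), phi ρ τ) + ∫ τ in (0 : ℝ)..a, phi ρ τ ≤ 1 := by
  have h : ∫ τ in a..(a + t), phi ρ τ ≤ ∫ _ in a..(a + t), phi ρ a :=
    intervalIntegral.integral_mono_on (by linarith) (phi_intervalIntegrable ρ _ _) (by simp)
      fun τ hτ => antitone_phi hρ hτ.1
  rw [intervalIntegral.integral_const, add_sub_cancel_left, smul_eq_mul] at h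
  have h2 : (1 / t) * (∫ τ in a..(a + t), phi ρ τ) ≤ phi ρ a := by
    rw [one_div, inv_mul_le_iff₀ ht]
    exact h
  linarith [phi_add_integral_le_one hρ ha0]

theorem integral_phi_add_integral_reflect (ρ a b : ℝ) :
    (∫ τ in a..b, phi ρ τ) + ∫ τ in (ρ - b)..(ρ - a), phi ρ τ = (b - a) * (2 * alpha0 ρ) := by
  have hint : IntervalIntegrable (fun τ => phi ρ (ρ - τ)) MeasureTheory.volume a b :=
    ((continuous_phi ρ).comp (continuous_sub_left ρ)).intervalIntegrable _ _
  rw [← intervalIntegral.integral_comp_sub_left (phi ρ) ρ,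
    ← intervalIntegral.integral_add (phi_intervalIntegrable ρ _ _) hint]
  simp only [phi_add_phi_reflect, intervalIntegral.integral_const, smul_eq_mul]

theorem stmt4 (ρ : ℝ) (hρ : 0 < ρ) (n : ℕ) (x : ℕ → ℝ)
    (hx : ∀ i < n, 0 < x i ∧ x i ≤ 1)
    (hsum : ∑ i ∈ Finset.range n, x i = ρ) :
    let xf : ℕ → ℝ := fun i => ∑ j ∈ Finset.range i, x j
    let xb : ℕ → ℝ := fun i => ∑ j ∈ Finset.Ico (i + 1) n, x j
    let cf : ℕ → ℝ := fun i => (1 / x i) * ∫ τ in (xf i)..(xf i + x i), phi ρ τ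
    let cb : ℕ → ℝ := fun i => (1 / x i) * ∫ τ in (xb i)..(xb i + x i), phi ρ τ
    LPFeasible n x cf cb ∧ ∀ i < n, (cf i + cb i) / 2 = alpha0 ρ := by
  intro xf xb cf cb
  have hxf0 : ∀ i < n, 0 ≤ xf i := fun i hi =>
    Finset.sum_nonneg fun j hj => (hx j ((Finset.mem_range.1 hj).trans hi)).1.le
  have hxb0 : ∀ i, 0 ≤ xb i := fun i =>
    Finset.sum_nonneg fun j hj => (hx j (Finset.mem_Ico.1 hj).2).1.le
  have hxf : ∀ i, xf i + x i = xf (i + 1) := fun i => (Finset.sum_range_succ x i).symm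
  have hxb : ∀ i < n, xb i + x i = ∑ j ∈ Finset.Ico i n, x j := fun i hi => by
    rw [Finset.sum_eq_sum_Ico_succ_bot hi, add_comm]
  have hmul : ∀ i < n, ∀ y : ℝ, x i * (1 / x i * y) = y := fun i hi y => by
    rw [← mul_assoc, mul_one_div_cancel (hx i hi).1.ne', one_mul]
  have hsumf : ∀ i < n, ∑ j ∈ Finset.range i, x j * cf j = ∫ τ in (0 : ℝ)..xf i, phi ρ τ := by
    intro i hi
    have h0 : xf 0 = 0 := Finset.sum_range_zero x
    rw [← h0, ← intervalIntegral.sum_integral_adjacent_intervals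
      fun k _ => phi_intervalIntegrable ρ (xf k) (xf (k + 1))]
    refine Finset.sum_congr rfl fun j hj => ?_
    rw [hmul j ((Finset.mem_range.1 hj).trans hi), hxf]
  have hsumb : ∀ i < n, ∑ j ∈ Finset.Ico (i + 1) n, x j * cb j =
      ∫ τ in (0 : ℝ)..xb i, phi ρ τ := by
    intro i hi
    have h0 : ∑ j ∈ Finset.Ico n n, x j = 0 := by simp
    rw [intervalIntegral.integral_symm, ← h0,
      ← intervalIntegral.sum_integral_adjacent_intervals_Ico
        (a := fun k => ∑ j ∈ Finset.Ico k n, x j) hi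
        fun k _ => phi_intervalIntegrable ρ _ _, ← Finset.sum_neg_distrib]
    refine Finset.sum_congr rfl fun j hj => ?_
    have hj' := (Finset.mem_Ico.1 hj).2
    rw [hmul j hj', hxb j hj', intervalIntegral.integral_symm]
  have hnonneg : ∀ a : ℝ, ∀ i < n, 0 ≤ (1 / x i) * ∫ τ in a..(a + x i), phi ρ τ :=
    fun a i hi => mul_nonneg (one_div_nonneg.2 (hx i hi).1.le)
      (intervalIntegral.integral_nonneg (by linarith [(hx i hi).1]) fun τ _ => phi_nonneg hρ τ)
  refine ⟨⟨fun i hi => hnonneg _ i hi, fun i hi => hnonneg _ i hi, fun i hi => ?_,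
    fun i hi => ?_⟩, fun i hi => ?_⟩
  · rw [hsumf i hi]
    exact average_phi_add_integral_le_one hρ (hxf0 i hi) (hx i hi).1
  · rw [hsumb i hi]
    exact average_phi_add_integral_le_one hρ (hxb0 i) (hx i hi).1
  · have htot : xf i + (xb i + x i) = ρ := by
      rw [hxb i hi, ← hsum, Finset.sum_range_add_sum_Ico x hi.le]
    have h := integral_phi_add_integral_reflect ρ (xf i) (xf i + x i)
    rw [show ρ - (xf i + x i) = xb i by linarith, show ρ - xf i = xb i + x i by linarith,
      add_sub_cancel_left] at h
    have hcc : cf i + cb i = 2 * alpha0 ρ := by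
      rw [← hmul i hi (2 * alpha0 ρ), mul_left_comm, ← h, mul_add]
    rw [hcc, mul_div_cancel_left₀ _ two_ne_zero]
end

section
/- Fix ρ > 0, n ≥ 0 and N = 2n+1. Define ξ : {1,…,N} → ℝ by ξ(i) = ρ·α₀(ρ) for i ≠ n+1 and ξ(n+1) = N·(1 − ρ·α₀(ρ)·(N−1)/N); define y_f : {1,…,N} → ℝ by y_f(i) = 0 for i < n+1, y_f(n+1) = ξ(n+1)/2 + 1/2, and y_f(i) = γ_ρ(ρ·i/N) for n+1 < i ≤ N; and define y_b(i) := y_f(N − (i−1)). Then ξ, y_f, y_b are nonnegative; Σ_{i=1}^N ξ(i)/N ≥ 1; for every i ∈ {1,…,N}, y_f(i) + Σ_{j>i} (ρ/N)·y_f(j) ≥ ξ(i)/2 and y_b(i) + Σ_{j<i} (ρ/N)·y_b(j) ≥ ξ(i)/2; and Σ_{i=1}^N (y_f(i) + y_b(i))/N ≤ α₀(ρ) + (ρ+2)/N. -/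
/-- The function `γ_ρ` from the paper, on `[ρ/2, ρ]`. -/
noncomputable def gammaFn (ρ : ℝ) (z : ℝ) : ℝ :=
  ρ * Real.exp (z - ρ / 2) / (2 * (1 + Real.exp (ρ / 2) * ρ))

theorem sub_le_sum_Icc_of_sub_le {f g : ℕ → ℝ} (h : ∀ j, g (j + 1) - g j ≤ f (j + 1)) {m k : ℕ}
    (hmk : m ≤ k) : g k - g m ≤ ∑ j ∈ Finset.Icc (m + 1) k, f j := by
  induction k, hmk using Nat.le_induction with
  | base => simp
  | succ k hk ih =>
    rw [Finset.sum_Icc_succ_top (by omega)]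
    linarith [h k]

theorem sum_Icc_le_sub_of_le_sub {f g : ℕ → ℝ} (h : ∀ j, f (j + 1) ≤ g (j + 1) - g j) {m k : ℕ}
    (hmk : m ≤ k) : ∑ j ∈ Finset.Icc (m + 1) k, f j ≤ g k - g m := by
  have := sub_le_sum_Icc_of_sub_le (f := fun j => -f j) (g := fun j => -g j)
    (fun j => by linarith [h j]) hmk
  rw [Finset.sum_neg_distrib] at this
  linarith

theorem sum_Icc_one_reflect (f : ℕ → ℝ) {N m : ℕ} (hm : m ≤ N) :
    ∑ j ∈ Finset.Icc 1 m, f (N - (j - 1)) = ∑ j ∈ Finset.Icc (N - m + 1) N, f j := by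
  refine Finset.sum_nbij' (fun j => N - (j - 1)) (fun j => N - (j - 1)) ?_ ?_ ?_ ?_ ?_ <;>
    intro j hj <;> simp only [Finset.mem_Icc] at hj ⊢ <;> omega

theorem sum_Icc_eq_add_of_eq_zero {f : ℕ → ℝ} {m n N : ℕ} (hmn : m ≤ n) (hnN : n < N)
    (hf : ∀ i < n + 1, f i = 0) :
    ∑ j ∈ Finset.Icc (m + 1) N, f j = f (n + 1) + ∑ j ∈ Finset.Icc (n + 2) N, f j := by
  have hins : Finset.Icc (n + 1) N = insert (n + 1) (Finset.Icc (n + 2) N) := by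
    ext j
    simp only [Finset.mem_Icc, Finset.mem_insert]
    omega
  rw [← Finset.sum_insert (by simp), ← hins]
  symm
  apply Finset.sum_subset
  · exact Finset.Icc_subset_Icc_left (by omega)
  · intro j hj hj'
    simp only [Finset.mem_Icc] at hj hj'
    exact hf j (by omega)

theorem exp_sub_one_le_mul_exp (x : ℝ) : Real.exp x - 1 ≤ x * Real.exp x := by
  have h := Real.add_one_le_exp (-x)
  rw [Real.exp_neg] at h
  have hx := Real.exp_pos x
  have := mul_le_mul_of_nonneg_right h hx.le
  rw [inv_mul_cancel₀ hx.ne'] at this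
  linarith

theorem alpha0_nonneg {ρ : ℝ} (hρ : 0 ≤ ρ) : 0 ≤ alpha0 ρ := by
  unfold alpha0
  positivity

theorem one_sub_mul_alpha0 {ρ : ℝ} (hρ : 0 ≤ ρ) :
    1 - ρ * alpha0 ρ = 1 / (1 + Real.exp (ρ / 2) * ρ) := by
  have : 0 < 1 + Real.exp (ρ / 2) * ρ := by positivity
  unfold alpha0
  field_simp
  ring

theorem mul_alpha0_le_one {ρ : ℝ} (hρ : 0 ≤ ρ) : ρ * alpha0 ρ ≤ 1 := by
  have h : 0 ≤ 1 / (1 + Real.exp (ρ / 2) * ρ) := by positivity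
  linarith [one_sub_mul_alpha0 hρ]

theorem alpha0_le_one {ρ : ℝ} (hρ : 0 ≤ ρ) : alpha0 ρ ≤ 1 := by
  unfold alpha0
  rw [div_le_one (by positivity)]
  nlinarith [exp_sub_one_le_mul_exp (ρ / 2), mul_nonneg hρ (Real.exp_pos (ρ / 2)).le]

theorem gammaFn_nonneg {ρ : ℝ} (hρ : 0 ≤ ρ) (z : ℝ) : 0 ≤ gammaFn ρ z := by
  unfold gammaFn
  positivity

theorem gammaFn_add (ρ z h : ℝ) : gammaFn ρ (z + h) = gammaFn ρ z * Real.exp h := by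
  unfold gammaFn
  rw [show z + h - ρ / 2 = (z - ρ / 2) + h by ring, Real.exp_add]
  ring

theorem gammaFn_self (ρ : ℝ) : gammaFn ρ ρ = ρ * alpha0 ρ / 2 := by
  unfold gammaFn alpha0
  rw [sub_half, mul_div_assoc', div_div, mul_comm 2]

theorem gammaFn_half {ρ : ℝ} (hρ : 0 ≤ ρ) : gammaFn ρ (ρ / 2) = ρ / 2 * (1 - ρ * alpha0 ρ) := by
  rw [one_sub_mul_alpha0 hρ]
  have : 0 < 1 + Real.exp (ρ / 2) * ρ := by positivity
  unfold gammaFn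
  rw [sub_self, Real.exp_zero]
  field_simp

theorem gammaFn_sub_le {ρ : ℝ} (hρ : 0 ≤ ρ) (z h : ℝ) :
    gammaFn ρ (z + h) - gammaFn ρ z ≤ h * gammaFn ρ (z + h) := by
  rw [gammaFn_add]
  nlinarith [mul_le_mul_of_nonneg_left (exp_sub_one_le_mul_exp h) (gammaFn_nonneg hρ z)]

theorem mul_gammaFn_le_sub {ρ : ℝ} (hρ : 0 ≤ ρ) (z h : ℝ) :
    h * gammaFn ρ z ≤ gammaFn ρ (z + h) - gammaFn ρ z := by
  rw [gammaFn_add]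
  nlinarith [mul_le_mul_of_nonneg_left (Real.add_one_le_exp h) (gammaFn_nonneg hρ z)]

theorem gammaFn_mono {ρ z w : ℝ} (hρ : 0 ≤ ρ) (hzw : z ≤ w) : gammaFn ρ z ≤ gammaFn ρ w := by
  have h := mul_gammaFn_le_sub hρ z (w - z)
  rw [add_sub_cancel] at h
  nlinarith [mul_nonneg (sub_nonneg.2 hzw) (gammaFn_nonneg hρ z)]

/-- The explicit dual solution `(ξ, y_f, y_b)` (indexed `1, …, N` with `N = 2n+1`) is
dual-feasible and has objective value at most `α₀(ρ) + (ρ+2)/N`. -/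
theorem stmt8 (ρ : ℝ) (hρ : 0 < ρ) (n : ℕ) :
    let N : ℕ := 2 * n + 1
    let ξ : ℕ → ℝ := fun i =>
      if i = n + 1 then (N : ℝ) * (1 - ρ * alpha0 ρ * ((N : ℝ) - 1) / (N : ℝ))
      else ρ * alpha0 ρ
    let yf : ℕ → ℝ := fun i =>
      if i < n + 1 then 0
      else if i = n + 1 then ξ (n + 1) / 2 + 1 / 2
      else gammaFn ρ (ρ * (i : ℝ) / (N : ℝ))
    let yb : ℕ → ℝ := fun i => yf (N - (i - 1))
    (∀ i ∈ Finset.Icc 1 N, 0 ≤ ξ i ∧ 0 ≤ yf i ∧ 0 ≤ yb i) ∧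
    (1 ≤ ∑ i ∈ Finset.Icc 1 N, ξ i / (N : ℝ)) ∧
    (∀ i ∈ Finset.Icc 1 N,
      ξ i / 2 ≤ yf i + ∑ j ∈ Finset.Icc (i + 1) N, (ρ / (N : ℝ)) * yf j ∧
      ξ i / 2 ≤ yb i + ∑ j ∈ Finset.Icc 1 (i - 1), (ρ / (N : ℝ)) * yb j) ∧
    (∑ i ∈ Finset.Icc 1 N, (yf i + yb i) / (N : ℝ) ≤ alpha0 ρ + (ρ + 2) / (N : ℝ)) := by
  intro N ξ yf yb
  have hN : (0 : ℝ) < N := by positivity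
  have hNn : (N : ℝ) = 2 * n + 1 := by simp [N]
  have hρ' := hρ.le
  set a := alpha0 ρ with ha
  have ha0 : 0 ≤ a := alpha0_nonneg hρ'
  have ha1 : a ≤ 1 := alpha0_le_one hρ'
  have hρa : ρ * a ≤ 1 := mul_alpha0_le_one hρ'
  have hρa0 : 0 ≤ ρ * a := mul_nonneg hρ' ha0
  set h := ρ / (N : ℝ) with hh
  have hh0 : 0 < h := div_pos hρ hN
  have hhN : h * N = ρ := div_mul_cancel₀ _ hN.ne'
  let g : ℕ → ℝ := fun j => gammaFn ρ (ρ * (j : ℝ) / (N : ℝ))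
  have hg0 : ∀ j, 0 ≤ g j := fun j => gammaFn_nonneg hρ' _
  have harg : ∀ j : ℕ, ρ * ((j + 1 : ℕ) : ℝ) / (N : ℝ) = ρ * (j : ℝ) / (N : ℝ) + h := by
    intro j
    rw [hh]
    push_cast
    ring
  have hg1 : ∀ j, g (j + 1) - g j ≤ h * g (j + 1) := by
    intro j
    simp only [g, harg]
    exact gammaFn_sub_le hρ' _ _
  have hg2 : ∀ j, h * g (j + 1) ≤ (1 + h) * g (j + 1) - (1 + h) * g j := by
    intro j
    have := mul_gammaFn_le_sub hρ' (ρ * (j : ℝ) / (N : ℝ)) h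
    rw [← harg] at this
    simp only [g]
    linarith
  have hgN : g N = ρ * a / 2 := by
    simp only [g]
    rw [mul_div_cancel_right₀ _ hN.ne', gammaFn_self]
  have hmid_arg : ρ * ((n + 1 : ℕ) : ℝ) / (N : ℝ) = ρ / 2 + h / 2 := by
    rw [hh]
    field_simp
    rw [hNn]
    push_cast
    ring
  have hmid_lower : ρ / 2 * (1 - ρ * a) ≤ g (n + 1) := by
    simp only [g]
    rw [hmid_arg, ← gammaFn_half hρ']
    exact gammaFn_mono hρ' (by linarith)
  have hmid_upper : g (n + 1) ≤ ρ / 2 * (1 - ρ * a) + h / 2 * (ρ * a / 2) := by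
    have h1 : g (n + 1) ≤ g N := by
      apply gammaFn_mono hρ'
      gcongr
      simp only [N]
      omega
    have h2 : g (n + 1) - ρ / 2 * (1 - ρ * a) ≤ h / 2 * g (n + 1) := by
      simp only [g]
      rw [hmid_arg, ← gammaFn_half hρ']
      exact gammaFn_sub_le hρ' _ _
    rw [hgN] at h1
    linarith [mul_le_mul_of_nonneg_left h1 (by positivity : 0 ≤ h / 2)]
  have hξ_mid : ξ (n + 1) = N * (1 - ρ * a) + ρ * a := by
    simp only [ξ, if_true]
    field_simp
    ring
  have hξ_ne : ∀ i, i ≠ n + 1 → ξ i = ρ * a := fun i hi => if_neg hi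
  have hξ_mid0 : 0 ≤ ξ (n + 1) := by
    rw [hξ_mid]
    have := mul_nonneg hN.le (sub_nonneg.2 hρa)
    linarith
  have hξ0 : ∀ i, 0 ≤ ξ i := by
    intro i
    by_cases hi : i = n + 1
    · rwa [hi]
    · rwa [hξ_ne i hi]
  have hyf_lt : ∀ i < n + 1, yf i = 0 := fun i hi => if_pos hi
  have hyf_mid : yf (n + 1) = ξ (n + 1) / 2 + 1 / 2 := by simp [yf]
  have hyf_gt : ∀ i, n + 1 < i → yf i = g i := by
    intro i hi
    simp only [yf, g]
    rw [if_neg (by omega), if_neg (by omega)]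
  have hyf0 : ∀ i, 0 ≤ yf i := by
    intro i
    rcases lt_trichotomy i (n + 1) with hi | hi | hi
    · rw [hyf_lt i hi]
    · rw [hi, hyf_mid]
      linarith
    · rw [hyf_gt i hi]
      exact hg0 i
  have hsum_gt : ∀ m, n + 1 ≤ m → ∑ j ∈ Finset.Icc (m + 1) N, h * yf j =
      ∑ j ∈ Finset.Icc (m + 1) N, h * g j := by
    intro m hm
    refine Finset.sum_congr rfl fun j hj => ?_
    rw [Finset.mem_Icc] at hj
    rw [hyf_gt j (by omega)]
  have hsum_le : ∀ m, m ≤ n → ∑ j ∈ Finset.Icc (m + 1) N, h * yf j =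
      h * yf (n + 1) + ∑ j ∈ Finset.Icc (n + 1 + 1) N, h * g j := by
    intro m hm
    rw [← hsum_gt (n + 1) le_rfl]
    exact sum_Icc_eq_add_of_eq_zero hm (by simp only [N]; omega)
      fun i hi => by rw [hyf_lt i hi, mul_zero]
  have hforward : ∀ i ≤ N, ξ i / 2 ≤ yf i + ∑ j ∈ Finset.Icc (i + 1) N, h * yf j := by
    intro i hi
    rcases lt_trichotomy i (n + 1) with hin | hin | hin
    · rw [hsum_le i (by omega), hξ_ne i hin.ne, hyf_lt i hin, hyf_mid, hξ_mid]
      have hs := sub_le_sum_Icc_of_sub_le (f := fun j => h * g j) hg1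
        (show n + 1 ≤ N by simp only [N]; omega)
      have e : h * ((N * (1 - ρ * a) + ρ * a) / 2 + 1 / 2) =
          ρ / 2 * (1 - ρ * a) + h * (ρ * a / 2) + h / 2 := by
        linear_combination (1 - ρ * a) / 2 * hhN
      rw [e]
      linarith [mul_nonneg hh0.le hρa0]
    · have : 0 ≤ ∑ j ∈ Finset.Icc (i + 1) N, h * yf j :=
        Finset.sum_nonneg fun j _ => mul_nonneg hh0.le (hyf0 j)
      rw [hin] at this ⊢
      linarith
    · rw [hsum_gt i hin.le, hξ_ne i hin.ne', hyf_gt i hin]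
      have hs := sub_le_sum_Icc_of_sub_le (f := fun j => h * g j) hg1 hi
      linarith
  refine ⟨fun i _ => ⟨hξ0 i, hyf0 i, hyf0 _⟩, ?_, ?_, ?_⟩
  · have hsplit : ∀ i, ξ i = ρ * a + if i = n + 1 then N * (1 - ρ * a) else 0 := by
      intro i
      split_ifs with hi
      · rw [hi, hξ_mid]
        ring
      · rw [hξ_ne i hi, add_zero]
    rw [← Finset.sum_div, Finset.sum_congr rfl fun i _ => hsplit i, Finset.sum_add_distrib,
      Finset.sum_const, Finset.sum_ite_eq', if_pos (by simp only [N, Finset.mem_Icc]; omega),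
      Nat.card_Icc, Nat.add_sub_cancel, nsmul_eq_mul, le_div_iff₀ hN]
    linarith
  · intro i hi
    rw [Finset.mem_Icc] at hi
    refine ⟨hforward i hi.2, ?_⟩
    have hξr : ξ i = ξ (N - (i - 1)) := by
      by_cases hin : i = n + 1
      · rw [hin]
        congr 1
        simp only [N]
        omega
      · rw [hξ_ne i hin, hξ_ne _ (by simp only [N] at hi ⊢; omega)]
    rw [hξr, show ∑ j ∈ Finset.Icc 1 (i - 1), h * yb j = _ from
      sum_Icc_one_reflect (fun j => h * yf j) (by omega)]
    exact hforward _ (Nat.sub_le _ _)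
  · have hyb : ∑ i ∈ Finset.Icc 1 N, yb i = ∑ i ∈ Finset.Icc 1 N, yf i := by
      rw [show ∑ i ∈ Finset.Icc 1 N, yb i = _ from sum_Icc_one_reflect yf le_rfl]
      simp
    have hS := hsum_le 0 (Nat.zero_le n)
    have hs := sum_Icc_le_sub_of_le_sub (f := fun j => h * g j) (g := fun j => (1 + h) * g j) hg2
      (show n + 1 ≤ N by simp only [N]; omega)
    rw [← Finset.mul_sum, zero_add, hyf_mid, hξ_mid] at hS
    simp only [hgN] at hs
    rw [← Finset.sum_div, Finset.sum_add_distrib, hyb, div_le_iff₀ hN, add_mul,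
      div_mul_cancel₀ _ hN.ne']
    have hl := mul_le_mul_of_nonneg_left hmid_lower (by positivity : 0 ≤ 1 + h)
    set S := ∑ i ∈ Finset.Icc 1 N, yf i
    have hhS : h * S ≤ h * ((a * N + (ρ + 2)) / 2) := by
      have hq : 0 ≤ h * (ρ * (1 - ρ * a)) :=
        mul_nonneg hh0.le (mul_nonneg hρ' (sub_nonneg.2 hρa))
      have hr : h * (ρ * a) ≤ h * 1 := mul_le_mul_of_nonneg_left hρa hh0.le
      have ht : h * (ρ * a) ≤ h * ρ :=
        mul_le_mul_of_nonneg_left (mul_le_of_le_one_right hρ' ha1) hh0.le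
      have e1 : h * ((N * (1 - ρ * a) + ρ * a) / 2 + 1 / 2) =
          ρ / 2 * (1 - ρ * a) + h * (ρ * a) / 2 + h / 2 := by
        linear_combination (1 - ρ * a) / 2 * hhN
      have e2 : h * ((a * N + (ρ + 2)) / 2) = ρ * a / 2 + h * ρ / 2 + h := by
        linear_combination a / 2 * hhN
      rw [hS, e1, e2]
      linarith
    linarith [le_of_mul_le_mul_left hhS hh0]
end
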